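/- arXiv:1105.4969 — 4 statements merged into one kernel-verified Lean document; each statement's English description precedes it below -/
import Mathlib

section
/- Let G be a group, H a subgroup of finite index, φ : H → G a group homomorphism, X a finite set, and h : X → G a complete set of left coset representatives of H in G (i.e., for every g ∈ G there is a unique x ∈ X with (h x)⁻¹·g ∈ H). Then there exists a group action of G on the set X* of finite words over X such that (i) every g ∈ G fixes the empty word, and (ii) for all g ∈ G, x ∈ X and every word v, if y ∈ X is the (unique) letter with (h y)⁻¹·g·(h x) ∈ H, then g·(x v) = y (φ((h y)⁻¹ g (h x))·v). Moreover, conditions (i) and (ii) determine this action uniquely. -/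
section SelfSimilar

variable {G X : Type*} [Group G] {H : Subgroup G}

/-- The self-similar map on words attached to `φ : H →* G` and representatives `h : X → G`, where
`r g` is the letter of the coset of `g`. -/
def selfSimilarMap (φ : H →* G) (h : X → G) (r : G → X)
    (hr : ∀ g, (h (r g))⁻¹ * g ∈ H) : G → List X → List X
  | _, [] => []
  | g, x :: v => r (g * h x) :: selfSimilarMap φ h r hr
      (φ ⟨(h (r (g * h x)))⁻¹ * g * h x, by simpa only [mul_assoc] using hr (g * h x)⟩) v

variable (φ : H →* G) (h : X → G) (r : G → X) (hr : ∀ g, (h (r g))⁻¹ * g ∈ H)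

theorem selfSimilarMap_cons (huniq : ∀ g x, (h x)⁻¹ * g ∈ H → x = r g) (g : G) (x y : X)
    (v : List X) (hy : (h y)⁻¹ * g * h x ∈ H) :
    selfSimilarMap φ h r hr g (x :: v) =
      y :: selfSimilarMap φ h r hr (φ ⟨(h y)⁻¹ * g * h x, hy⟩) v := by
  obtain rfl : y = r (g * h x) := huniq _ _ (by simpa only [mul_assoc] using hy)
  rfl

theorem selfSimilarMap_one (huniq : ∀ g x, (h x)⁻¹ * g ∈ H → x = r g) (v : List X) :
    selfSimilarMap φ h r hr 1 v = v := by
  induction v with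
  | nil => rfl
  | cons x v ih =>
    have hx : (h x)⁻¹ * 1 * h x = 1 := by group
    have hmem : (h x)⁻¹ * 1 * h x ∈ H := by rw [hx]; exact H.one_mem
    rw [selfSimilarMap_cons φ h r hr huniq 1 x x v hmem,
      show (⟨(h x)⁻¹ * 1 * h x, hmem⟩ : H) = 1 from Subtype.ext hx, map_one, ih]

theorem selfSimilarMap_mul (huniq : ∀ g x, (h x)⁻¹ * g ∈ H → x = r g) (g g' : G) (v : List X) :
    selfSimilarMap φ h r hr (g * g') v =
      selfSimilarMap φ h r hr g (selfSimilarMap φ h r hr g' v) := by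
  induction v generalizing g g' with
  | nil => rfl
  | cons x v ih =>
    have hy : (h (r (g' * h x)))⁻¹ * g' * h x ∈ H := by
      simpa only [mul_assoc] using hr (g' * h x)
    generalize r (g' * h x) = y at hy
    have hz : (h (r (g * h y)))⁻¹ * g * h y ∈ H := by
      simpa only [mul_assoc] using hr (g * h y)
    generalize r (g * h y) = z at hz
    have hmul : (h z)⁻¹ * (g * g') * h x = (h z)⁻¹ * g * h y * ((h y)⁻¹ * g' * h x) := by group
    have hmem : (h z)⁻¹ * (g * g') * h x ∈ H := hmul ▸ H.mul_mem hz hy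
    rw [selfSimilarMap_cons φ h r hr huniq g' x y v hy,
      selfSimilarMap_cons φ h r hr huniq g y z _ hz,
      selfSimilarMap_cons φ h r hr huniq (g * g') x z v hmem, ← ih, ← map_mul,
      show (⟨(h z)⁻¹ * (g * g') * h x, hmem⟩ : H) = ⟨_, hz⟩ * ⟨_, hy⟩ from Subtype.ext hmul]

end SelfSimilar


/-- existence and uniqueness of the self-similar action of `G` on words
over `X` associated to the triple `(G, φ, h)`, where `h : X → G` is a complete set of
left coset representatives of `H` in `G`. -/
theorem exists_unique_self_similar_action
    {G X : Type*} [Group G] [Fintype X] (H : Subgroup G) (hHfin : H.FiniteIndex)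
    (φ : H →* G) (h : X → G)
    (hrep : ∀ g : G, ∃! x : X, (h x)⁻¹ * g ∈ H) :
    ∃! act : G → List X → List X,
      (∀ v, act 1 v = v) ∧
      (∀ g g' v, act (g * g') v = act g (act g' v)) ∧
      (∀ g, act g [] = []) ∧
      (∀ (g : G) (x y : X) (v : List X) (hy : (h y)⁻¹ * g * h x ∈ H),
        act g (x :: v) = y :: act (φ ⟨(h y)⁻¹ * g * h x, hy⟩) v) := by
  choose r hr huniq using hrep
  refine ⟨selfSimilarMap φ h r hr, ⟨selfSimilarMap_one φ h r hr huniq,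
    selfSimilarMap_mul φ h r hr huniq, fun _ => rfl, selfSimilarMap_cons φ h r hr huniq⟩, ?_⟩
  rintro act ⟨-, -, hnil, hcons⟩
  funext g v
  induction v generalizing g with
  | nil => exact hnil g
  | cons x v ih =>
    have hy : (h (r (g * h x)))⁻¹ * g * h x ∈ H := by
      simpa only [mul_assoc] using hr (g * h x)
    rw [hcons g x _ v hy, ih, selfSimilarMap_cons φ h r hr huniq g x _ v hy]
end

section
/- Let G be a group, H a subgroup of finite index, φ : H → G a group homomorphism, X a finite set, and h : X → G a complete set of left coset representatives of H in G. Suppose G acts on the set X* of finite words over X so that every g ∈ G fixes the empty word and, for all g ∈ G, x ∈ X, word v, and the unique y ∈ X with (h y)⁻¹·g·(h x) ∈ H, one has g·(x v) = y (φ((h y)⁻¹ g (h x))·v). Then the action is self-similar at every word: for every g ∈ G and every word v there exists an element g|_v ∈ G (the state of g at v) such that g·(v w) = (g·v)(g|_v·w) for all words w. -/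
/-- a self-similar action associated to a virtual endomorphism is
self-similar at every word: every `g ∈ G` has a state `g|_v` at every word `v`. -/
theorem self_similar_action_has_states
    {G X : Type*} [Group G] [Fintype X] (H : Subgroup G) (hHfin : H.FiniteIndex)
    (φ : H →* G) (h : X → G)
    (hrep : ∀ g : G, ∃! x : X, (h x)⁻¹ * g ∈ H)
    (act : G → List X → List X)
    (hact_one : ∀ v, act 1 v = v)
    (hact_mul : ∀ g g' v, act (g * g') v = act g (act g' v))
    (hnil : ∀ g, act g [] = [])
    (hrec : ∀ (g : G) (x y : X) (v : List X) (hy : (h y)⁻¹ * g * h x ∈ H),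
      act g (x :: v) = y :: act (φ ⟨(h y)⁻¹ * g * h x, hy⟩) v) :
    ∀ (g : G) (v : List X), ∃ s : G, ∀ w : List X,
      act g (v ++ w) = act g v ++ act s w := by
  intro g v
  induction v generalizing g with
  | nil => exact ⟨g, fun w => by simp [hnil]⟩
  | cons x v ih =>
    obtain ⟨y, hy, -⟩ := hrep (g * h x)
    have hy' : (h y)⁻¹ * g * h x ∈ H := by simpa only [mul_assoc] using hy
    obtain ⟨s, hs⟩ := ih (φ ⟨(h y)⁻¹ * g * h x, hy'⟩)
    refine ⟨s, fun w => ?_⟩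
    rw [List.cons_append, hrec g x y _ hy', hrec g x y _ hy', hs, List.cons_append]
end

section
/- Let 𝓛 be a finite-dimensional normed real Lie algebra and φ : 𝓛 → 𝓛 a Lie algebra automorphism. Then the set C = { v ∈ 𝓛 : φ^n(v) → 0 as n → ∞ } is a Lie subalgebra of 𝓛 (it is a linear subspace closed under the Lie bracket), and it is φ-invariant in the strong sense that v ∈ C if and only if φ(v) ∈ C. -/
/-- A bilinear map on a finite-dimensional normed space is bounded. -/
theorem exists_norm_bilinear_le {E : Type*} [NormedAddCommGroup E] [NormedSpace ℝ E]
    [FiniteDimensional ℝ E] (B : E →ₗ[ℝ] E →ₗ[ℝ] E) :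
    ∃ K : ℝ, ∀ v w, ‖B v w‖ ≤ K * ‖v‖ * ‖w‖ := by
  let B' : E →L[ℝ] E →L[ℝ] E := LinearMap.toContinuousLinearMap
    ((LinearMap.toContinuousLinearMap : (E →ₗ[ℝ] E) ≃ₗ[ℝ] (E →L[ℝ] E)).toLinearMap ∘ₗ B)
  exact ⟨‖B'‖, fun v w => B'.le_opNorm₂ v w⟩

/-- A bilinear map on a finite-dimensional space is bounded with respect to any function
satisfying the axioms of a norm. -/
theorem exists_bilinear_le_of_norm_axioms {E : Type*} [AddCommGroup E] [Module ℝ E]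
    [FiniteDimensional ℝ E] (N : E → ℝ)
    (hN_nonneg : ∀ v, 0 ≤ N v)
    (hN_zero : ∀ v, N v = 0 ↔ v = 0)
    (hN_add : ∀ v w, N (v + w) ≤ N v + N w)
    (hN_smul : ∀ (c : ℝ) (v : E), N (c • v) = |c| * N v)
    (B : E →ₗ[ℝ] E →ₗ[ℝ] E) :
    ∃ K : ℝ, ∀ v w, N (B v w) ≤ K * N v * N w := by
  let : Norm E := ⟨N⟩
  have core : NormedSpace.Core ℝ E :=
    { norm_nonneg := hN_nonneg
      norm_smul := hN_smul
      norm_triangle := hN_add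
      norm_eq_zero_iff := hN_zero }
  let : NormedAddCommGroup E := NormedAddCommGroup.ofCore core
  let : NormedSpace ℝ E := NormedSpace.ofCore core
  exact exists_norm_bilinear_le B

/-- for an automorphism `φ` of a finite-dimensional normed real Lie
algebra `𝓛`, the set `C = {v | φⁿ(v) → 0}` is a Lie subalgebra, and `v ∈ C ↔ φ(v) ∈ C`. -/
theorem contracting_set_is_lie_subalgebra
    {L : Type*} [LieRing L] [LieAlgebra ℝ L] [FiniteDimensional ℝ L]
    (N : L → ℝ)
    (hN_zero : ∀ v, N v = 0 ↔ v = 0)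
    (hN_add : ∀ v w, N (v + w) ≤ N v + N w)
    (hN_smul : ∀ (c : ℝ) (v : L), N (c • v) = |c| * N v)
    (φ : L ≃ₗ⁅ℝ⁆ L) :
    ∃ C : LieSubalgebra ℝ L,
      (C : Set L) =
        {v : L | Filter.Tendsto (fun n => N ((⇑φ)^[n] v)) Filter.atTop (nhds 0)} ∧
      ∀ v : L, v ∈ C ↔ φ v ∈ C := by
  have hN_nonneg : ∀ v, 0 ≤ N v := fun v => by
    have hadd := hN_add v ((-1 : ℝ) • v)
    have hzero : N (v + (-1 : ℝ) • v) = 0 := (hN_zero _).2 (by simp)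
    rw [hzero, hN_smul] at hadd
    norm_num at hadd
    linarith
  obtain ⟨K, hK⟩ := exists_bilinear_le_of_norm_axioms N hN_nonneg hN_zero hN_add hN_smul
    (LieModule.toEnd ℝ L L : L →ₗ[ℝ] L →ₗ[ℝ] L)
  have iter_add (n : ℕ) (v w : L) : φ^[n] (v + w) = φ^[n] v + φ^[n] w :=
    Function.Semiconj₂.iterate (f := φ) (op := (· + ·)) (map_add φ) n v w
  have iter_lie (n : ℕ) (v w : L) : φ^[n] ⁅v, w⁆ = ⁅φ^[n] v, φ^[n] w⁆ :=
    Function.Semiconj₂.iterate (f := φ) (op := (⁅·, ·⁆)) (LieEquiv.map_lie φ) n v w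
  have iter_smul (n : ℕ) (c : ℝ) (v : L) : φ^[n] (c • v) = c • φ^[n] v :=
    (Function.Commute.iterate_left (f := φ) (g := (c • ·)) (map_smul φ c) n) v
  have iter_zero (n : ℕ) : φ^[n] 0 = 0 := Function.iterate_fixed (map_zero φ) n
  refine ⟨{ carrier := {v : L | Filter.Tendsto (fun n => N (φ^[n] v)) Filter.atTop (nhds 0)}
            add_mem' := ?_, zero_mem' := ?_, smul_mem' := ?_, lie_mem' := ?_ }, rfl, ?_⟩
  · intro v w hv hw
    refine squeeze_zero (fun n => hN_nonneg _) (fun n => ?_) (by simpa using hv.add hw)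
    rw [iter_add]
    exact hN_add _ _
  · simp [iter_zero, (hN_zero 0).2 rfl]
  · intro c v hv
    simpa [iter_smul, hN_smul] using Filter.Tendsto.const_mul |c| hv
  · intro v w hv hw
    refine squeeze_zero (fun n => hN_nonneg _) (fun n => ?_)
      (by simpa using (Filter.Tendsto.const_mul K hv).mul hw)
    rw [iter_lie]
    exact hK _ _
  · intro v
    exact (Filter.tendsto_add_atTop_iff_nat (f := fun n => N (φ^[n] v)) 1).symm
end

section
/- Let 𝓛 be a finite-dimensional complex nilpotent Lie algebra with lower central series 𝓛⁽⁰⁾ = 𝓛, 𝓛⁽ⁱ⁺¹⁾ = [𝓛, 𝓛⁽ⁱ⁾], and let φ : 𝓛 → 𝓛 be a Lie algebra automorphism. Then φ maps each term 𝓛⁽ⁱ⁾ onto itself and induces a linear endomorphism φ̄_i of the quotient 𝓛⁽ⁱ⁾/𝓛⁽ⁱ⁺¹⁾; moreover, every eigenvalue of φ̄_i is a product λ_1·λ_2⋯λ_{i+1} of i+1 (not necessarily distinct) eigenvalues of the induced endomorphism φ̄_0 of 𝓛/[𝓛,𝓛]. -/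
namespace Module.End

variable {U V W : Type*} [AddCommGroup U] [Module ℂ U] [AddCommGroup V] [Module ℂ V]
  [AddCommGroup W] [Module ℂ W]

/-- A bilinear map intertwining `f`, `g` with `h` sends generalized eigenvectors for `a` and `b`
to generalized eigenvectors for `a * b`. -/
theorem bilin_mem_maxGenEigenspace_mul (B : U →ₗ[ℂ] V →ₗ[ℂ] W) {f : End ℂ U} {g : End ℂ V}
    {h : End ℂ W} (hB : ∀ u v, h (B u v) = B (f u) (g v)) {a b : ℂ} {u : U} {v : V}
    (hu : u ∈ f.maxGenEigenspace a) (hv : v ∈ g.maxGenEigenspace b) :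
    B u v ∈ h.maxGenEigenspace (a * b) := by
  rw [mem_maxGenEigenspace] at hu hv
  obtain ⟨m, hm⟩ := hu
  obtain ⟨n, hn⟩ := hv
  induction m generalizing n u v with
  | zero =>
    have hu0 : u = 0 := by simpa using hm
    simp [hu0]
  | succ m ihm =>
    induction n generalizing v with
    | zero =>
      have hv0 : v = 0 := by simpa using hn
      simp [hv0]
    | succ n ihn =>
      have h₁ : B ((f - a • (1 : End ℂ U)) u) (g v) ∈ h.maxGenEigenspace (a * b) := by
        refine ihm (by rwa [pow_succ] at hm) (n + 1) ?_
        have hc : Commute ((g - b • (1 : End ℂ V)) ^ (n + 1)) g :=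
          (((Commute.refl g).sub_left ((Commute.one_left g).smul_left b))).pow_left _
        rw [← mul_apply, hc.eq, mul_apply, hn, map_zero]
      have h₂ : B u ((g - b • (1 : End ℂ V)) v) ∈ h.maxGenEigenspace (a * b) :=
        ihn (by rwa [pow_succ] at hn)
      have key : (h - (a * b) • (1 : End ℂ W)) (B u v) =
          B ((f - a • (1 : End ℂ U)) u) (g v) + a • B u ((g - b • (1 : End ℂ V)) v) := by
        simp [hB, smul_sub, mul_smul]
      have h₃ := add_mem h₁ (Submodule.smul_mem _ a h₂)
      rw [← key, mem_maxGenEigenspace] at h₃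
      obtain ⟨k, hk⟩ := h₃
      rw [mem_maxGenEigenspace]
      exact ⟨k + 1, by rw [pow_succ, mul_apply, hk]⟩

/-- If the values of a bilinear map intertwining `f`, `g` with `h` span the target, then every
eigenvalue of `h` is a product of an eigenvalue of `f` and one of `g`. -/
theorem HasEigenvalue.exists_mul_of_bilin [FiniteDimensional ℂ U] [FiniteDimensional ℂ V]
    (B : U →ₗ[ℂ] V →ₗ[ℂ] W) {f : End ℂ U} {g : End ℂ V} {h : End ℂ W}
    (hB : ∀ u v, h (B u v) = B (f u) (g v))
    (hspan : Submodule.span ℂ {w | ∃ u v, B u v = w} = ⊤) {c : ℂ} (hc : h.HasEigenvalue c) :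
    ∃ a b, f.HasEigenvalue a ∧ g.HasEigenvalue b ∧ c = a * b := by
  by_contra! hne
  have hmem : ∀ u v, B u v ∈ ⨆ d ≠ c, h.maxGenEigenspace d := by
    intro u v
    have hu : u ∈ ⨆ a, f.maxGenEigenspace a := by simp [iSup_maxGenEigenspace_eq_top]
    have hv : v ∈ ⨆ b, g.maxGenEigenspace b := by simp [iSup_maxGenEigenspace_eq_top]
    induction hu using Submodule.iSup_induction' with
    | zero => simp
    | add x y _ _ hx hy => rw [map_add, LinearMap.add_apply]; exact add_mem hx hy
    | mem a u hu =>
      induction hv using Submodule.iSup_induction' with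
      | zero => simp
      | add x y _ _ hx hy => rw [map_add]; exact add_mem hx hy
      | mem b v hv =>
        by_cases hu0 : u = 0
        · simp [hu0]
        by_cases hv0 : v = 0
        · simp [hv0]
        have ha : f.HasEigenvalue a := by
          apply HasUnifEigenvalue.lt (k := ⊤) zero_lt_one
          exact fun h0 => hu0 (by simpa [maxGenEigenspace, h0] using hu)
        have hb : g.HasEigenvalue b := by
          apply HasUnifEigenvalue.lt (k := ⊤) zero_lt_one
          exact fun h0 => hv0 (by simpa [maxGenEigenspace, h0] using hv)
        exact Submodule.mem_iSup_of_mem (a * b) (Submodule.mem_iSup_of_mem (hne a b ha hb).symm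
          (bilin_mem_maxGenEigenspace_mul B hB hu hv))
  have htop : (⨆ d ≠ c, h.maxGenEigenspace d) = ⊤ := by
    rw [eq_top_iff, ← hspan, Submodule.span_le]
    rintro _ ⟨u, v, rfl⟩
    exact hmem u v
  have hdisj := h.independent_maxGenEigenspace c
  rw [htop, disjoint_top] at hdisj
  obtain ⟨w, hw⟩ := hc.exists_hasEigenvector
  refine hw.2 ?_
  have : w ∈ h.maxGenEigenspace c :=
    (h.genEigenspace c).monotone le_top hw.1
  rwa [hdisj, Submodule.mem_bot] at this

end Module.End

namespace LieModule

variable {L : Type*} [LieRing L] [LieAlgebra ℂ L]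

/-- The `i`-th quotient of the lower central series. -/
abbrev LcsQuotient (L : Type*) [LieRing L] [LieAlgebra ℂ L] (i : ℕ) : Type _ :=
  (lowerCentralSeries ℂ L L i : Submodule ℂ L) ⧸
    (lowerCentralSeries ℂ L L (i + 1) : Submodule ℂ L).comap
      (lowerCentralSeries ℂ L L i : Submodule ℂ L).subtype

theorem lie_mem_lowerCentralSeries_succ (x : L) {y : L} {i : ℕ}
    (hy : y ∈ lowerCentralSeries ℂ L L i) : ⁅x, y⁆ ∈ lowerCentralSeries ℂ L L (i + 1) := by
  rw [lowerCentralSeries_succ]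
  exact LieSubmodule.lie_mem_lie (LieSubmodule.mem_top x) hy

theorem mem_lowerCentralSeries_succ_iff {i : ℕ} {z : L} :
    z ∈ lowerCentralSeries ℂ L L (i + 1) ↔
      z ∈ Submodule.span ℂ {z | ∃ x : L, ∃ y ∈ lowerCentralSeries ℂ L L i, ⁅x, y⁆ = z} := by
  rw [lowerCentralSeries_succ, ← LieSubmodule.mem_toSubmodule,
    LieSubmodule.lieIdeal_oper_eq_linear_span']
  simp

theorem lie_mem_lowerCentralSeries_add_two {x y : L} {i : ℕ}
    (hx : x ∈ lowerCentralSeries ℂ L L 1) (hy : y ∈ lowerCentralSeries ℂ L L i) :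
    ⁅x, y⁆ ∈ lowerCentralSeries ℂ L L (i + 2) := by
  rw [mem_lowerCentralSeries_succ_iff] at hx
  induction hx using Submodule.span_induction with
  | mem x hx =>
    obtain ⟨a, b, -, rfl⟩ := hx
    rw [lie_lie]
    exact sub_mem
      (lie_mem_lowerCentralSeries_succ a (lie_mem_lowerCentralSeries_succ b hy))
      (lie_mem_lowerCentralSeries_succ b (lie_mem_lowerCentralSeries_succ a hy))
  | zero => simp
  | add a b _ _ ha hb => rw [add_lie]; exact add_mem ha hb
  | smul t a _ ha => rw [smul_lie]; exact (lowerCentralSeries ℂ L L (i + 2)).smul_mem t ha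

theorem map_mem_lowerCentralSeries (φ : L →ₗ⁅ℂ⁆ L) {i : ℕ} {x : L}
    (hx : x ∈ lowerCentralSeries ℂ L L i) : φ x ∈ lowerCentralSeries ℂ L L i := by
  induction i generalizing x with
  | zero => simp
  | succ i ih =>
    rw [mem_lowerCentralSeries_succ_iff] at hx
    induction hx using Submodule.span_induction with
    | mem x hx =>
      obtain ⟨a, b, hb, rfl⟩ := hx
      rw [LieHom.map_lie]
      exact lie_mem_lowerCentralSeries_succ _ (ih hb)
    | zero => simp
    | add a b _ _ ha hb => rw [map_add]; exact add_mem ha hb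
    | smul t a _ ha =>
      rw [map_smul]; exact (lowerCentralSeries ℂ L L (i + 1)).smul_mem t ha

/-- The endomorphism induced on the `i`-th quotient of the lower central series. -/
def lcsQuotientMap (φ : L →ₗ⁅ℂ⁆ L) (i : ℕ) : Module.End ℂ (LcsQuotient L i) :=
  Submodule.mapQ _ _
    ((φ : L →ₗ[ℂ] L).restrict fun _ hx => map_mem_lowerCentralSeries φ hx)
    fun _ hx => map_mem_lowerCentralSeries φ hx

/-- The endomorphism induced on the abelianization. -/
def abelianizationMap (φ : L →ₗ⁅ℂ⁆ L) :
    Module.End ℂ (L ⧸ (lowerCentralSeries ℂ L L 1 : Submodule ℂ L)) :=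
  Submodule.mapQ _ _ (φ : L →ₗ[ℂ] L) fun _ hx => map_mem_lowerCentralSeries φ hx

/-- The bracket as a bilinear map into the next quotient of the lower central series. -/
def lcsBracketAux (i : ℕ) :
    (lowerCentralSeries ℂ L L i : Submodule ℂ L) →ₗ[ℂ] L →ₗ[ℂ] LcsQuotient L (i + 1) :=
  LinearMap.mk₂ ℂ
    (fun y x => Submodule.Quotient.mk ⟨⁅x, (y : L)⁆, lie_mem_lowerCentralSeries_succ x y.2⟩)
    (fun _ _ _ => congrArg Submodule.Quotient.mk (Subtype.ext (lie_add _ _ _)))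
    (fun _ _ _ => congrArg Submodule.Quotient.mk (Subtype.ext (lie_smul _ _ _)))
    (fun _ _ _ => congrArg Submodule.Quotient.mk (Subtype.ext (add_lie _ _ _)))
    (fun _ _ _ => congrArg Submodule.Quotient.mk (Subtype.ext (smul_lie _ _ _)))

/-- The bilinear map induced by the bracket on the quotients of the lower central series. -/
def lcsBracket (i : ℕ) :
    (L ⧸ (lowerCentralSeries ℂ L L 1 : Submodule ℂ L)) →ₗ[ℂ]
      LcsQuotient L i →ₗ[ℂ] LcsQuotient L (i + 1) :=
  Submodule.liftQ _
    (Submodule.liftQ _ (lcsBracketAux i) (by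
      intro y hy
      ext x
      exact (Submodule.Quotient.mk_eq_zero _).2 (lie_mem_lowerCentralSeries_succ x hy))).flip
    (by
      intro x hx
      refine LinearMap.ext fun q => ?_
      obtain ⟨y, rfl⟩ := Submodule.Quotient.mk_surjective _ q
      exact (Submodule.Quotient.mk_eq_zero _).2 (lie_mem_lowerCentralSeries_add_two hx y.2))

theorem lcsBracket_mk (i : ℕ) (x : L) (y : (lowerCentralSeries ℂ L L i : Submodule ℂ L)) :
    lcsBracket i (Submodule.Quotient.mk x) (Submodule.Quotient.mk y) =
      Submodule.Quotient.mk ⟨⁅x, (y : L)⁆, lie_mem_lowerCentralSeries_succ x y.2⟩ :=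
  rfl

theorem lcsQuotientMap_lcsBracket (φ : L →ₗ⁅ℂ⁆ L) (i : ℕ)
    (u : L ⧸ (lowerCentralSeries ℂ L L 1 : Submodule ℂ L)) (v : LcsQuotient L i) :
    lcsQuotientMap φ (i + 1) (lcsBracket i u v) =
      lcsBracket i (abelianizationMap φ u) (lcsQuotientMap φ i v) := by
  obtain ⟨x, rfl⟩ := Submodule.Quotient.mk_surjective _ u
  obtain ⟨y, rfl⟩ := Submodule.Quotient.mk_surjective _ v
  exact congrArg Submodule.Quotient.mk (Subtype.ext (LieHom.map_lie φ x y))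

theorem span_lcsBracket (i : ℕ) :
    Submodule.span ℂ {w | ∃ u v, lcsBracket (L := L) i u v = w} = ⊤ := by
  rw [eq_top_iff]
  rintro w -
  obtain ⟨⟨z, hz⟩, rfl⟩ := Submodule.Quotient.mk_surjective _ w
  have hz' := mem_lowerCentralSeries_succ_iff.1 hz
  induction hz' using Submodule.span_induction with
  | mem z h =>
    obtain ⟨x, y, hy, rfl⟩ := h
    exact Submodule.subset_span
      ⟨Submodule.Quotient.mk x, Submodule.Quotient.mk ⟨y, hy⟩, rfl⟩
  | zero => exact zero_mem _
  | add a b ha hb iha ihb =>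
    exact add_mem (iha (mem_lowerCentralSeries_succ_iff.2 ha))
      (ihb (mem_lowerCentralSeries_succ_iff.2 hb))
  | smul t a ha iha =>
    exact Submodule.smul_mem _ t (iha (mem_lowerCentralSeries_succ_iff.2 ha))

theorem hasEigenvalue_abelianizationMap_of_zero {φ : L →ₗ⁅ℂ⁆ L} {μ : ℂ}
    (hμ : (lcsQuotientMap φ 0).HasEigenvalue μ) : (abelianizationMap φ).HasEigenvalue μ := by
  obtain ⟨w, hw⟩ := hμ.exists_hasEigenvector
  obtain ⟨x, rfl⟩ := Submodule.Quotient.mk_surjective _ w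
  refine Module.End.hasEigenvalue_of_hasEigenvector (x := Submodule.Quotient.mk (x : L)) ⟨?_, ?_⟩
  · rw [Module.End.mem_eigenspace_iff]
    have h : φ x - μ • (x : L) ∈ (lowerCentralSeries ℂ L L 1 : Submodule ℂ L) :=
      (Submodule.Quotient.eq ((lowerCentralSeries ℂ L L 1 : Submodule ℂ L).comap
        (lowerCentralSeries ℂ L L 0 : Submodule ℂ L).subtype)
        (x := ⟨φ x, map_mem_lowerCentralSeries φ x.2⟩) (y := μ • x)).1 hw.apply_eq_smul
    exact (Submodule.Quotient.eq _).2 h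
  · intro h
    rw [Submodule.Quotient.mk_eq_zero] at h
    exact hw.2 ((Submodule.Quotient.mk_eq_zero _).2 h)

theorem exists_prod_of_hasEigenvalue_lcsQuotientMap [FiniteDimensional ℂ L] (φ : L →ₗ⁅ℂ⁆ L)
    (i : ℕ) {μ : ℂ} (hμ : (lcsQuotientMap φ i).HasEigenvalue μ) :
    ∃ lam : Fin (i + 1) → ℂ,
      (∀ j, (abelianizationMap φ).HasEigenvalue (lam j)) ∧ μ = ∏ j, lam j := by
  induction i generalizing μ with
  | zero => exact ⟨fun _ => μ, fun _ => hasEigenvalue_abelianizationMap_of_zero hμ, by simp⟩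
  | succ i ih =>
    obtain ⟨a, b, ha, hb, rfl⟩ := hμ.exists_mul_of_bilin (lcsBracket i)
      (lcsQuotientMap_lcsBracket φ i) (span_lcsBracket i)
    obtain ⟨lam, hlam, rfl⟩ := ih hb
    exact ⟨Fin.cons a lam, Fin.cases ha hlam, by rw [Fin.prod_cons]⟩

end LieModule

/-- an automorphism `φ` of a finite-dimensional complex nilpotent Lie
algebra maps each term of the lower central series onto itself and induces
endomorphisms `ψᵢ` of the quotients `𝓛⁽ⁱ⁾/𝓛⁽ⁱ⁺¹⁾`; every eigenvalue of `ψᵢ` is a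
product of `i+1` eigenvalues of the endomorphism `ψ₀` induced on `𝓛/[𝓛,𝓛]`. -/
theorem lcs_quotient_eigenvalues_are_products
    {L : Type*} [LieRing L] [LieAlgebra ℂ L] [FiniteDimensional ℂ L]
    (hnilp : ∃ n : ℕ, LieModule.lowerCentralSeries ℂ L L n = ⊥)
    (φ : L ≃ₗ⁅ℂ⁆ L) :
    (∀ i : ℕ, ⇑φ '' ((LieModule.lowerCentralSeries ℂ L L i : Submodule ℂ L) : Set L) =
        ((LieModule.lowerCentralSeries ℂ L L i : Submodule ℂ L) : Set L)) ∧
    ∃ ψ₀ : Module.End ℂ (L ⧸ (LieModule.lowerCentralSeries ℂ L L 1 : Submodule ℂ L)),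
      (∀ v : L, ψ₀ (Submodule.Quotient.mk v) = Submodule.Quotient.mk (φ v)) ∧
      ∀ i : ℕ,
        ∃ ψ : Module.End ℂ
            ((LieModule.lowerCentralSeries ℂ L L i : Submodule ℂ L) ⧸
              (LieModule.lowerCentralSeries ℂ L L (i + 1) : Submodule ℂ L).comap
                (LieModule.lowerCentralSeries ℂ L L i : Submodule ℂ L).subtype),
          (∀ x y : (LieModule.lowerCentralSeries ℂ L L i : Submodule ℂ L),
            φ (x : L) = (y : L) →
              ψ (Submodule.Quotient.mk x) = Submodule.Quotient.mk y) ∧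
          ∀ μ : ℂ, Module.End.HasEigenvalue ψ μ →
            ∃ lam : Fin (i + 1) → ℂ,
              (∀ j, Module.End.HasEigenvalue ψ₀ (lam j)) ∧ μ = ∏ j, lam j := by
  refine ⟨fun i => ?_, LieModule.abelianizationMap φ.toLieHom, fun _ => rfl, fun i =>
    ⟨LieModule.lcsQuotientMap φ.toLieHom i, fun x y hxy => ?_, fun μ hμ =>
      LieModule.exists_prod_of_hasEigenvalue_lcsQuotientMap φ.toLieHom i hμ⟩⟩
  · refine Set.Subset.antisymm ?_ fun x hx => ?_
    · rintro _ ⟨x, hx, rfl⟩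
      exact LieModule.map_mem_lowerCentralSeries φ.toLieHom hx
    · exact ⟨φ.symm x, LieModule.map_mem_lowerCentralSeries φ.symm.toLieHom hx,
        φ.apply_symm_apply x⟩
  · exact congrArg Submodule.Quotient.mk (Subtype.ext hxy)
end
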